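/- Let A be a bounded residuated lattice, k > 0, and b : A → A a function such that for every a ∈ A, b(a) is a Boolean element and aᵏ ≤ b(a) ≤ k.a. Then for every a ∈ A: (a) b(aᵏ) ≤ b(a); (b) m.b(a) = b(a) for every m > 0; (c) b(b(a)) = b(a); (d) aᵏ ≤ ¬ b(¬a) ≤ k.a; (e) k.(aᵏ) ≤ (k.a)ᵏ. -/

import Mathlib

universe u

/-- A bounded (integral, commutative) residuated lattice: a bounded lattice
with a commutative monoid operation `mul` (with unit `⊤`) and a residuum
`himp` satisfying the residuation condition. -/
class BRL (α : Type u) extends Lattice α, BoundedOrder α where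
  mul : α → α → α
  himp : α → α → α
  mul_comm : ∀ a b : α, mul a b = mul b a
  mul_assoc : ∀ a b c : α, mul (mul a b) c = mul a (mul b c)
  mul_top : ∀ a : α, mul a ⊤ = a
  residuation : ∀ a b c : α, mul a b ≤ c ↔ a ≤ himp b c

namespace BRL

variable {α : Type u} [BRL α]

/-- `¬a := a → ⊥`. -/
def neg (a : α) : α := himp a ⊥

/-- `a + b := ¬(¬a · ¬b)`. -/
def add (a b : α) : α := neg (mul (neg a) (neg b))

/-- Powers: `a⁰ = ⊤`, `aⁿ⁺¹ = a · aⁿ`. -/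
def pow (a : α) : ℕ → α
  | 0 => ⊤
  | n + 1 => mul a (pow a n)

/-- Multiples: `0.a = ⊥`, `(n+1).a = a + n.a`. -/
def nmul : ℕ → α → α
  | 0, _ => ⊥
  | n + 1, a => add a (nmul n a)

/-- Implicative filter. -/
def IsFilter (F : Set α) : Prop :=
  ⊤ ∈ F ∧ (∀ a b : α, a ∈ F → a ≤ b → b ∈ F) ∧
    (∀ a b : α, a ∈ F → b ∈ F → mul a b ∈ F)

/-- The smallest implicative filter containing `S`. -/
def genFilter (S : Set α) : Set α := ⋂₀ {F : Set α | IsFilter F ∧ S ⊆ F}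

/-- Maximal (proper) implicative filter. -/
def IsMaximal (M : Set α) : Prop :=
  IsFilter M ∧ M ≠ Set.univ ∧ ∀ G : Set α, IsFilter G → M ⊂ G → G = Set.univ

/-- Prime (proper) implicative filter. -/
def IsPrime (P : Set α) : Prop :=
  IsFilter P ∧ P ≠ Set.univ ∧ ∀ a b : α, a ⊔ b ∈ P → a ∈ P ∨ b ∈ P

/-- Minimal prime implicative filter (minimal among prime implicative filters). -/
def IsMinimalPrime (P : Set α) : Prop :=
  IsPrime P ∧ ∀ Q : Set α, IsPrime Q → Q ⊆ P → Q = P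

/-- The radical: intersection of all maximal implicative filters. -/
def Rad : Set α := {a : α | ∀ M : Set α, IsMaximal M → a ∈ M}

/-- Boolean (complemented) element. -/
def Boolean (b : α) : Prop := b ⊔ neg b = ⊤

/-- Stone ultrafilter: an implicative filter generated by an ultrafilter of
the Boolean algebra of Boolean elements. -/
def IsStoneUltra (F : Set α) : Prop :=
  IsFilter F ∧ F = genFilter (F ∩ {b : α | Boolean b}) ∧ (⊥ : α) ∉ F ∧
    ∀ b : α, Boolean b → b ∈ F ∨ neg b ∈ F

theorem mul_mono {a b c d : α} (hab : a ≤ b) (hcd : c ≤ d) : mul a c ≤ mul b d := by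
  have right_mono : ∀ {x y : α} (z : α), x ≤ y → mul x z ≤ mul y z := fun z h =>
    (residuation _ _ _).2 (h.trans ((residuation _ _ _).1 le_rfl))
  calc mul a c ≤ mul b c := right_mono c hab
    _ = mul c b := mul_comm _ _
    _ ≤ mul d b := right_mono b hcd
    _ = mul b d := mul_comm _ _

theorem mul_le_left (a b : α) : mul a b ≤ a :=
  (mul_mono le_rfl le_top).trans_eq (mul_top a)

theorem le_neg_iff {a b : α} : a ≤ neg b ↔ mul a b ≤ ⊥ := (residuation _ _ _).symm

theorem neg_mul_self_le (a : α) : mul (neg a) a ≤ ⊥ := le_neg_iff.1 le_rfl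

theorem le_neg_comm {a b : α} : a ≤ neg b ↔ b ≤ neg a := by
  rw [le_neg_iff, le_neg_iff, mul_comm]

theorem le_neg_neg (a : α) : a ≤ neg (neg a) := le_neg_comm.1 le_rfl

theorem neg_anti {a b : α} (h : a ≤ b) : neg b ≤ neg a :=
  le_neg_comm.1 (h.trans (le_neg_neg b))

theorem neg_neg_neg (a : α) : neg (neg (neg a)) = neg a :=
  le_antisymm (neg_anti (le_neg_neg a)) (le_neg_neg _)

theorem neg_top : neg (⊤ : α) = ⊥ :=
  le_bot_iff.1 ((mul_top _).symm.trans_le (neg_mul_self_le ⊤))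

theorem neg_mul_neg_neg (a b : α) : neg (mul a (neg (neg b))) = neg (mul a b) := by
  refine le_antisymm (neg_anti (mul_mono le_rfl (le_neg_neg b))) ?_
  rw [le_neg_iff, ← mul_assoc, ← le_neg_iff, neg_neg_neg, le_neg_iff, mul_assoc]
  exact neg_mul_self_le _

theorem pow_mono {a b : α} (h : a ≤ b) (n : ℕ) : pow a n ≤ pow b n := by
  induction n with
  | zero => exact le_rfl
  | succ n ih => exact mul_mono h ih

theorem nmul_eq_neg_pow (n : ℕ) (a : α) : nmul n a = neg (pow (neg a) n) := by
  induction n with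
  | zero => exact neg_top.symm
  | succ n ih =>
    change neg (mul (neg a) (neg (nmul n a))) = neg (mul (neg a) (pow (neg a) n))
    rw [ih, neg_mul_neg_neg]

theorem nmul_mono {a b : α} (n : ℕ) (h : a ≤ b) : nmul n a ≤ nmul n b := by
  rw [nmul_eq_neg_pow, nmul_eq_neg_pow]
  exact neg_anti (pow_mono (neg_anti h) n)

theorem pow_le_neg_nmul_neg (n : ℕ) (a : α) : pow a n ≤ neg (nmul n (neg a)) := by
  rw [nmul_eq_neg_pow]
  exact (pow_mono (le_neg_neg a) n).trans (le_neg_neg _)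

theorem Boolean.mul_self {c : α} (hc : Boolean c) : mul c c = c := by
  refine le_antisymm (mul_le_left c c) ?_
  have h : ⊤ ≤ himp c (mul c c) := by
    rw [← show c ⊔ neg c = ⊤ from hc]
    exact sup_le ((residuation _ _ _).1 le_rfl)
      ((residuation _ _ _).1 ((neg_mul_self_le c).trans bot_le))
  have h' := (residuation _ _ _).2 h
  rwa [mul_comm, mul_top] at h'

theorem Boolean.neg_neg {c : α} (hc : Boolean c) : neg (neg c) = c := by
  refine le_antisymm ?_ (le_neg_neg c)
  have h : ⊤ ≤ himp (neg (neg c)) c := by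
    rw [← show c ⊔ neg c = ⊤ from hc]
    refine sup_le ((residuation _ _ _).1 (mul_le_left _ _)) ((residuation _ _ _).1 ?_)
    rw [mul_comm]
    exact (neg_mul_self_le (neg c)).trans bot_le
  have h' := (residuation _ _ _).2 h
  rwa [mul_comm, mul_top] at h'

theorem Boolean.neg {c : α} (hc : Boolean c) : Boolean (neg c) := by
  change BRL.neg c ⊔ BRL.neg (BRL.neg c) = ⊤
  rw [hc.neg_neg, sup_comm]
  exact hc

theorem Boolean.pow_eq {c : α} (hc : Boolean c) {n : ℕ} (hn : 0 < n) : pow c n = c := by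
  induction n, hn using Nat.le_induction with
  | base => exact mul_top c
  | succ n _ ih =>
    change mul c (pow c n) = c
    rw [ih, hc.mul_self]

theorem Boolean.nmul_eq {c : α} (hc : Boolean c) {n : ℕ} (hn : 0 < n) : nmul n c = c := by
  rw [nmul_eq_neg_pow, hc.neg.pow_eq hn, hc.neg_neg]

theorem boolean_term_props (k : ℕ) (hk : 0 < k) (b : α → α)
    (hb : ∀ a : α, Boolean (b a) ∧ pow a k ≤ b a ∧ b a ≤ nmul k a) :
    ∀ a : α,
      b (pow a k) ≤ b a ∧
      (∀ m : ℕ, 0 < m → nmul m (b a) = b a) ∧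
      b (b a) = b a ∧
      (pow a k ≤ neg (b (neg a)) ∧ neg (b (neg a)) ≤ nmul k a) ∧
      nmul k (pow a k) ≤ pow (nmul k a) k := by
  intro a
  obtain ⟨hB, hl, hu⟩ := hb a
  have nmul_pow_le : nmul k (pow a k) ≤ b a := (nmul_mono k hl).trans_eq (hB.nmul_eq hk)
  refine ⟨(hb _).2.2.trans nmul_pow_le, fun m hm => hB.nmul_eq hm, ?_, ⟨?_, ?_⟩, ?_⟩
  · obtain ⟨-, hl', hu'⟩ := hb (b a)
    rw [hB.pow_eq hk] at hl'
    rw [hB.nmul_eq hk] at hu'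
    exact le_antisymm hu' hl'
  · exact (pow_le_neg_nmul_neg k a).trans (neg_anti (hb (neg a)).2.2)
  · rw [nmul_eq_neg_pow]
    exact neg_anti (hb (neg a)).2.1
  · calc nmul k (pow a k) ≤ b a := nmul_pow_le
      _ = pow (b a) k := (hB.pow_eq hk).symm
      _ ≤ pow (nmul k a) k := pow_mono hu k

end BRL
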